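/- arXiv:2403.15608 — 3 statements merged into one kernel-verified Lean document; each statement's English description precedes it below -/
import Mathlib

section
/- For every real number t and every integer n ≥ 1, the sum over core words of length n satisfies ∑_{ω ∈ G_n} c_ω^t ≤ e^{n·P(t)}. -/
open Filter

/-- The weight `c_ω` of a word `ω` over the alphabet `{0,1}` (here `false` is the
letter 0 and `true` is the letter 1): the product of `c0` over letters 0 and `c1`
over letters 1. -/
noncomputable def wt (c0 c1 : ℝ) (w : List Bool) : ℝ :=
  (w.map fun b => if b then c1 else c0).prod

/-- All words of length `n` over the alphabet `{0,1}`. -/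
def allWords : ℕ → Finset (List Bool)
  | 0 => {[]}
  | n + 1 => (allWords n).biUnion fun w => {false :: w, true :: w}

/-- Membership in the language of the S-gap shift: every maximal block of 0s lying
strictly between two 1s has length in `S`. -/
def InLang (S : Set ℕ) (w : List Bool) : Prop :=
  ∀ u v : List Bool, ∀ m : ℕ,
    w = u ++ [true] ++ List.replicate m false ++ [true] ++ v → m ∈ S

/-- Membership in the core set `G`: words of the form `0^{s₁}1 0^{s₂}1 ⋯ 0^{s_k}1`
with `k ≥ 1` and every `s_i ∈ S`. -/
def InCore (S : Set ℕ) (w : List Bool) : Prop :=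
  ∃ bs : List ℕ, bs ≠ [] ∧ (∀ s ∈ bs, s ∈ S) ∧
    w = (bs.map fun s => List.replicate s false ++ [true]).flatten

/-- `L_n`: the words of length `n` in the language of the S-gap shift. -/
noncomputable def langWords (S : Set ℕ) (n : ℕ) : Finset (List Bool) :=
  @Finset.filter _ (InLang S) (Classical.decPred _) (allWords n)

/-- `G_n`: the core words of length `n`. -/
noncomputable def coreWords (S : Set ℕ) (n : ℕ) : Finset (List Bool) :=
  @Finset.filter _ (InCore S) (Classical.decPred _) (allWords n)

theorem mem_allWords {n : ℕ} {w : List Bool} : w ∈ allWords n ↔ w.length = n := by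
  induction n generalizing w with
  | zero => simp [allWords]
  | succ n ih =>
    simp only [allWords, Finset.mem_biUnion, ih, Finset.mem_insert, Finset.mem_singleton]
    constructor
    · rintro ⟨v, rfl, rfl | rfl⟩ <;> simp
    · cases w with
      | nil => simp
      | cons b v => cases b <;> simp

theorem mem_coreWords {S : Set ℕ} {n : ℕ} {w : List Bool} :
    w ∈ coreWords S n ↔ w.length = n ∧ InCore S w := by
  simp [coreWords, mem_allWords]

theorem mem_langWords {S : Set ℕ} {n : ℕ} {w : List Bool} :
    w ∈ langWords S n ↔ w.length = n ∧ InLang S w := by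
  simp [langWords, mem_allWords]

theorem wt_append (c0 c1 : ℝ) (u v : List Bool) :
    wt c0 c1 (u ++ v) = wt c0 c1 u * wt c0 c1 v := by
  simp [wt]

theorem wt_pos {c0 c1 : ℝ} (hc0 : 0 < c0) (hc1 : 0 < c1) (w : List Bool) :
    0 < wt c0 c1 w := by
  induction w with
  | nil => simp [wt]
  | cons b w ih =>
    rw [← List.singleton_append, wt_append]
    refine mul_pos ?_ ih
    cases b <;> simpa [wt]

theorem InCore.append {S : Set ℕ} {u v : List Bool} (hu : InCore S u) (hv : InCore S v) :
    InCore S (u ++ v) := by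
  obtain ⟨bs, hne, hbs, rfl⟩ := hu
  obtain ⟨cs, -, hcs, rfl⟩ := hv
  refine ⟨bs ++ cs, by simp [hne], fun s hs => ?_, by simp⟩
  rcases List.mem_append.1 hs with h | h
  exacts [hbs s h, hcs s h]

theorem replicate_false_append_true_inj {s m : ℕ} {x y : List Bool}
    (h : List.replicate s false ++ true :: x = List.replicate m false ++ true :: y) :
    s = m := by
  induction s generalizing m with
  | zero => cases m <;> simp_all [List.replicate_succ]
  | succ s ih =>
    cases m with
    | zero => simp [List.replicate_succ] at h
    | succ m =>
      simp only [List.replicate_succ, List.cons_append, List.cons.injEq, true_and] at h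
      rw [ih h]

/-- An occurrence of a word starting with the letter 1 in `0^s 1 x` either starts at the displayed
letter 1 or lies inside `x`. -/
theorem eq_or_exists_of_replicate_append_eq {s : ℕ} {x u z : List Bool}
    (h : List.replicate s false ++ true :: x = u ++ true :: z) :
    x = z ∨ ∃ u', x = u' ++ true :: z := by
  induction s generalizing u with
  | zero =>
    cases u with
    | nil => left; simpa using h
    | cons b u =>
      simp only [List.replicate_zero, List.nil_append, List.cons_append, List.cons.injEq] at h
      exact Or.inr ⟨u, h.2⟩
  | succ s ih =>
    cases u with
    | nil => simp [List.replicate_succ] at h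
    | cons b u =>
      simp only [List.replicate_succ, List.cons_append, List.cons.injEq] at h
      exact ih h.2

theorem InCore.inLang {S : Set ℕ} {w : List Bool} (hw : InCore S w) : InLang S w := by
  obtain ⟨bs, -, hbs, rfl⟩ := hw
  intro u v m h
  simp only [List.append_assoc, List.singleton_append] at h
  induction bs generalizing u with
  | nil => simp at h
  | cons s bs ih =>
    simp only [List.map_cons, List.flatten_cons, List.append_assoc, List.singleton_append] at h
    rcases eq_or_exists_of_replicate_append_eq h with h | ⟨u', h⟩
    · cases bs with
      | nil => simp at h
      | cons r bs =>
        simp only [List.map_cons, List.flatten_cons, List.append_assoc,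
          List.singleton_append] at h
        rw [← replicate_false_append_true_inj h]
        exact hbs r (by simp)
    · exact ih (fun r hr => hbs r (List.mem_cons_of_mem _ hr)) u' h

theorem coreWords_subset_langWords (S : Set ℕ) (n : ℕ) : coreWords S n ⊆ langWords S n := by
  intro w hw
  rw [mem_coreWords] at hw
  exact mem_langWords.2 ⟨hw.1, hw.2.inLang⟩

theorem sum_coreWords_mul_le {c0 c1 : ℝ} (hc0 : 0 < c0) (hc1 : 0 < c1) (S : Set ℕ) (t : ℝ)
    (m n : ℕ) :
    (∑ ω ∈ coreWords S m, wt c0 c1 ω ^ t) * ∑ ω ∈ coreWords S n, wt c0 c1 ω ^ t ≤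
      ∑ ω ∈ coreWords S (m + n), wt c0 c1 ω ^ t := by
  have hinj : Set.InjOn (fun p : List Bool × List Bool => p.1 ++ p.2)
      (coreWords S m ×ˢ coreWords S n : Finset (List Bool × List Bool)) := by
    rintro ⟨u, v⟩ h ⟨u', v'⟩ h' heq
    simp only [Finset.coe_product, Set.mem_prod, Finset.mem_coe, mem_coreWords] at h h'
    obtain ⟨h₁, h₂⟩ := List.append_inj heq (h.1.1.trans h'.1.1.symm)
    exact Prod.ext h₁ h₂
  calc _ = ∑ p ∈ coreWords S m ×ˢ coreWords S n, wt c0 c1 (p.1 ++ p.2) ^ t := by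
        rw [Finset.sum_mul_sum, Finset.sum_product]
        refine Finset.sum_congr rfl fun u _ => Finset.sum_congr rfl fun v _ => ?_
        rw [wt_append, Real.mul_rpow (wt_pos hc0 hc1 u).le (wt_pos hc0 hc1 v).le]
    _ = ∑ ω ∈ (coreWords S m ×ˢ coreWords S n).image (fun p => p.1 ++ p.2), wt c0 c1 ω ^ t :=
        (Finset.sum_image (f := fun ω => wt c0 c1 ω ^ t) hinj).symm
    _ ≤ _ := by
        refine Finset.sum_le_sum_of_subset_of_nonneg ?_
          fun ω _ _ => Real.rpow_nonneg (wt_pos hc0 hc1 ω).le t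
        intro w hw
        obtain ⟨⟨u, v⟩, h, rfl⟩ := Finset.mem_image.1 hw
        simp only [Finset.mem_product, mem_coreWords] at h
        exact mem_coreWords.2 ⟨by simp [h.1.1, h.2.1], h.1.2.append h.2.2⟩

theorem sum_coreWords_pow_le {c0 c1 : ℝ} (hc0 : 0 < c0) (hc1 : 0 < c1) (S : Set ℕ) (t : ℝ)
    (n k : ℕ) :
    (∑ ω ∈ coreWords S n, wt c0 c1 ω ^ t) ^ (k + 1) ≤
      ∑ ω ∈ coreWords S ((k + 1) * n), wt c0 c1 ω ^ t := by
  induction k with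
  | zero => simp
  | succ k ih =>
    rw [pow_succ, Nat.succ_mul (k + 1) n]
    exact (mul_le_mul_of_nonneg_right ih <| Finset.sum_nonneg
      fun ω _ => Real.rpow_nonneg (wt_pos hc0 hc1 ω).le t).trans
        (sum_coreWords_mul_le hc0 hc1 S t _ n)

/-- For every real number t and every integer n ≥ 1, the sum over core
words of length n satisfies ∑_{ω ∈ G_n} c_ω^t ≤ e^{n·P(t)}. -/
theorem stmt0
    (S : Set ℕ) (hS : S.Infinite)
    (c0 c1 cb0 cb1 : ℝ)
    (hc0 : 0 < c0) (hc0b : c0 ≤ cb0) (hcb0 : cb0 < 1)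
    (hc1 : 0 < c1) (hc1b : c1 ≤ cb1) (hcb1 : cb1 < 1)
    (P Pb : ℝ → ℝ)
    (hP : ∀ t : ℝ, Filter.Tendsto
      (fun n : ℕ => (1 / (n : ℝ)) * Real.log (∑ ω ∈ langWords S n, wt c0 c1 ω ^ t))
      Filter.atTop (nhds (P t)))
    (hPb : ∀ t : ℝ, Filter.Tendsto
      (fun n : ℕ => (1 / (n : ℝ)) * Real.log (∑ ω ∈ langWords S n, wt cb0 cb1 ω ^ t))
      Filter.atTop (nhds (Pb t)))
    :
    ∀ t : ℝ, ∀ n : ℕ, 1 ≤ n →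
      ∑ ω ∈ coreWords S n, wt c0 c1 ω ^ t ≤ Real.exp (n * P t) := by
  intro t n hn
  set g := ∑ ω ∈ coreWords S n, wt c0 c1 ω ^ t
  rcases le_or_gt g 0 with h0 | hpos
  · exact h0.trans (Real.exp_pos _).le
  rw [← Real.log_le_iff_le_exp hpos]
  have hsub : Tendsto (fun k : ℕ => (k + 1) * n) atTop atTop :=
    tendsto_atTop_mono (fun k => (Nat.le_succ k).trans (Nat.le_mul_of_pos_right _ hn)) tendsto_id
  have hlim := ((hP t).comp hsub).const_mul (n : ℝ)
  refine ge_of_tendsto' hlim fun k => ?_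
  have hle : g ^ (k + 1) ≤ ∑ ω ∈ langWords S ((k + 1) * n), wt c0 c1 ω ^ t :=
    (sum_coreWords_pow_le hc0 hc1 S t n k).trans <|
      Finset.sum_le_sum_of_subset_of_nonneg (coreWords_subset_langWords S _)
        fun ω _ _ => Real.rpow_nonneg (wt_pos hc0 hc1 ω).le t
  have hlog := Real.log_le_log (pow_pos hpos _) hle
  rw [Real.log_pow] at hlog
  have hn0 : (0 : ℝ) < n := by exact_mod_cast hn
  have hk0 : (0 : ℝ) < (k : ℝ) + 1 := by positivity
  simp only [Function.comp_apply]
  push_cast at hlog ⊢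
  rw [one_div, mul_inv, mul_comm ((k : ℝ) + 1)⁻¹, mul_assoc, mul_inv_cancel_left₀ hn0.ne',
    le_inv_mul_iff₀ hk0]
  exact hlog
end

section
/- Let t ∈ ℝ satisfy c₀^t < e^{P(t)} and c₁^t < e^{P(t)}. Then there exists a constant K₁ > 0 such that ∑_{ω ∈ L_n} c_ω^t ≤ K₁·e^{n·P(t)} for every integer n ≥ 1. -/
open Filter

theorem wt_append_rpow {c0 c1 : ℝ} (hc0 : 0 < c0) (hc1 : 0 < c1) (t : ℝ) (u v : List Bool) :
    wt c0 c1 (u ++ v) ^ t = wt c0 c1 u ^ t * wt c0 c1 v ^ t := by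
  rw [wt_append, Real.mul_rpow (wt_pos hc0 hc1 u).le (wt_pos hc0 hc1 v).le]

theorem InLang.of_append_left {S : Set ℕ} {x w : List Bool} (h : InLang S (x ++ w)) :
    InLang S w := fun u v m hw => h (x ++ u) v m (by simp [hw])

theorem InLang.of_append_right {S : Set ℕ} {x w : List Bool} (h : InLang S (x ++ w)) :
    InLang S x := fun u v m hx => h u (v ++ w) m (by simp [hx])

/-- Two words of the language can be glued along a common letter 1. -/
theorem InLang.glue {S : Set ℕ} {u v : List Bool} (hu : InLang S (u ++ [true]))
    (hv : InLang S (true :: v)) : InLang S (u ++ true :: v) := by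
  intro x y m h
  have h' : u ++ true :: v = x ++ true :: (List.replicate m false ++ true :: y) := by
    simpa using h
  rcases List.append_eq_append_iff.1 h' with ⟨z, rfl, hz⟩ | ⟨z, rfl, hz⟩
  · exact hv z y m (by simpa using hz)
  · rcases z with _ | ⟨b, z⟩
    · exact hv [] y m (by simpa using hz.symm)
    · simp only [List.cons_append, List.cons.injEq] at hz
      obtain ⟨rfl, hz⟩ := hz
      rcases List.append_eq_append_iff.1 hz with ⟨q, rfl, hq⟩ | ⟨q, hq, hq'⟩
      · rcases q with _ | ⟨b, q⟩
        · exact hu x [] m (by simp)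
        · simp only [List.cons_append, List.cons.injEq] at hq
          obtain ⟨rfl, -⟩ := hq
          exact hu x (q ++ [true]) m (by simp)
      · rcases q with _ | ⟨b, q⟩
        · simp only [List.append_nil] at hq
          exact hu x [] m (by simp [hq])
        · simp only [List.cons_append, List.cons.injEq] at hq'
          obtain ⟨rfl, -⟩ := hq'
          have : true ∈ List.replicate m false := by simp [hq]
          simp at this

/-- The words `w` of length `n` such that `1w` is in the language. -/
noncomputable def followWords (S : Set ℕ) (n : ℕ) : Finset (List Bool) :=
  @Finset.filter _ (fun w => InLang S (true :: w)) (Classical.decPred _) (allWords n)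

/-- The words `w` of length `n` such that `1w` is in the language and ends with the letter 1. -/
noncomputable def returnWords (S : Set ℕ) (n : ℕ) : Finset (List Bool) :=
  @Finset.filter _ (fun w => InLang S (true :: w) ∧ ∃ u, true :: w = u ++ [true])
    (Classical.decPred _) (allWords n)

theorem mem_followWords {S : Set ℕ} {n : ℕ} {w : List Bool} :
    w ∈ followWords S n ↔ w.length = n ∧ InLang S (true :: w) := by
  simp [followWords, mem_allWords]

theorem mem_returnWords {S : Set ℕ} {n : ℕ} {w : List Bool} :
    w ∈ returnWords S n ↔
      w.length = n ∧ InLang S (true :: w) ∧ ∃ u, true :: w = u ++ [true] := by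
  simp [returnWords, mem_allWords]

theorem append_mem_returnWords {S : Set ℕ} {m n : ℕ} {u v : List Bool}
    (hu : u ∈ returnWords S m) (hv : v ∈ returnWords S n) : u ++ v ∈ returnWords S (m + n) := by
  rw [mem_returnWords] at *
  obtain ⟨rfl, hu, x, hx⟩ := hu
  obtain ⟨rfl, hv, y, hy⟩ := hv
  have h : true :: (u ++ v) = x ++ true :: v := by
    rw [← List.cons_append, hx]; simp
  refine ⟨by simp, ?_, x ++ y, ?_⟩
  · rw [h]
    exact InLang.glue (hx ▸ hu) hv
  · rw [h, hy, List.append_assoc]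

theorem sum_le_add_of_subset_union {α : Type*} [DecidableEq α] {f : α → ℝ} (hf : ∀ x, 0 ≤ f x)
    {A B C : Finset α} (h : A ⊆ B ∪ C) : ∑ x ∈ A, f x ≤ ∑ x ∈ B, f x + ∑ x ∈ C, f x := by
  rw [← Finset.sum_union_inter]
  exact (Finset.sum_le_sum_of_subset_of_nonneg h fun x _ _ => hf x).trans
    (le_add_of_nonneg_right (Finset.sum_nonneg fun x _ => hf x))

section Sums

variable {S : Set ℕ} {c0 c1 : ℝ}

theorem sum_langWords_succ_le (hc0 : 0 < c0) (hc1 : 0 < c1) (t : ℝ) (n : ℕ) :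
    ∑ ω ∈ langWords S (n + 1), wt c0 c1 ω ^ t ≤
      c0 ^ t * ∑ ω ∈ langWords S n, wt c0 c1 ω ^ t +
        c1 ^ t * ∑ ω ∈ followWords S n, wt c0 c1 ω ^ t := by
  have hpos (w : List Bool) : 0 ≤ wt c0 c1 w ^ t := Real.rpow_nonneg (wt_pos hc0 hc1 w).le t
  have hsub : langWords S (n + 1) ⊆
      (langWords S n).image (List.cons false) ∪ (followWords S n).image (List.cons true) := by
    intro w hw
    rw [mem_langWords] at hw
    obtain ⟨hn, hw⟩ := hw
    rcases w with _ | ⟨b, w⟩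
    · simp at hn
    · cases b
      · exact Finset.mem_union_left _ (Finset.mem_image_of_mem _ (mem_langWords.2
          ⟨by simpa using hn, InLang.of_append_left (x := [false]) hw⟩))
      · exact Finset.mem_union_right _ (Finset.mem_image_of_mem _ (mem_followWords.2
          ⟨by simpa using hn, hw⟩))
  have hcons (b : Bool) (A : Finset (List Bool)) :
      ∑ ω ∈ A.image (List.cons b), wt c0 c1 ω ^ t =
        (if b then c1 else c0) ^ t * ∑ ω ∈ A, wt c0 c1 ω ^ t := by
    rw [Finset.sum_image (by simp), Finset.mul_sum]
    refine Finset.sum_congr rfl fun w _ => ?_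
    rw [← List.singleton_append, wt_append_rpow hc0 hc1]
    simp [wt]
  refine (sum_le_add_of_subset_union hpos hsub).trans_eq ?_
  rw [hcons, hcons]
  simp

theorem sum_followWords_succ_le (hc0 : 0 < c0) (hc1 : 0 < c1) (t : ℝ) (n : ℕ) :
    ∑ ω ∈ followWords S (n + 1), wt c0 c1 ω ^ t ≤
      c0 ^ t * ∑ ω ∈ followWords S n, wt c0 c1 ω ^ t +
        ∑ ω ∈ returnWords S (n + 1), wt c0 c1 ω ^ t := by
  have hpos (w : List Bool) : 0 ≤ wt c0 c1 w ^ t := Real.rpow_nonneg (wt_pos hc0 hc1 w).le t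
  have hsub : followWords S (n + 1) ⊆
      (followWords S n).image (· ++ [false]) ∪ returnWords S (n + 1) := by
    intro w hw
    rw [mem_followWords] at hw
    obtain ⟨hn, hw⟩ := hw
    rcases List.eq_nil_or_concat' w with rfl | ⟨w, b, rfl⟩
    · simp at hn
    · cases b
      · exact Finset.mem_union_left _ (Finset.mem_image_of_mem _ (mem_followWords.2
          ⟨by simpa using hn, InLang.of_append_right (w := [false]) hw⟩))
      · exact Finset.mem_union_right _ (mem_returnWords.2 ⟨hn, hw, true :: w, rfl⟩)
  refine (sum_le_add_of_subset_union hpos hsub).trans_eq ?_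
  rw [Finset.sum_image (by simp), Finset.mul_sum]
  congr 1
  refine Finset.sum_congr rfl fun w _ => ?_
  rw [wt_append_rpow hc0 hc1, mul_comm]
  simp [wt]

theorem sum_returnWords_mul_le (hc0 : 0 < c0) (hc1 : 0 < c1) (t : ℝ) (m n : ℕ) :
    (∑ ω ∈ returnWords S m, wt c0 c1 ω ^ t) * ∑ ω ∈ returnWords S n, wt c0 c1 ω ^ t ≤
      ∑ ω ∈ returnWords S (m + n), wt c0 c1 ω ^ t := by
  have hinj : Set.InjOn (fun p : List Bool × List Bool => p.1 ++ p.2)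
      (returnWords S m ×ˢ returnWords S n : Finset _) := by
    rintro ⟨u, v⟩ huv ⟨u', v'⟩ huv' h
    simp only [Finset.coe_product, Set.mem_prod, Finset.mem_coe, mem_returnWords] at huv huv'
    obtain ⟨rfl, rfl⟩ := List.append_inj h (huv.1.1.trans huv'.1.1.symm)
    rfl
  rw [Finset.sum_mul_sum, ← Finset.sum_product']
  simp_rw [← wt_append_rpow hc0 hc1]
  rw [← Finset.sum_image (f := fun ω => wt c0 c1 ω ^ t) hinj]
  refine Finset.sum_le_sum_of_subset_of_nonneg ?_ fun w _ _ =>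
    Real.rpow_nonneg (wt_pos hc0 hc1 w).le t
  intro w hw
  obtain ⟨p, hp, rfl⟩ := Finset.mem_image.1 hw
  exact append_mem_returnWords (Finset.mem_product.1 hp).1 (Finset.mem_product.1 hp).2

theorem sum_returnWords_le_sum_langWords (hc0 : 0 < c0) (hc1 : 0 < c1) (t : ℝ) (n : ℕ) :
    ∑ ω ∈ returnWords S n, wt c0 c1 ω ^ t ≤ ∑ ω ∈ langWords S n, wt c0 c1 ω ^ t := by
  refine Finset.sum_le_sum_of_subset_of_nonneg ?_ fun w _ _ =>
    Real.rpow_nonneg (wt_pos hc0 hc1 w).le t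
  intro w hw
  rw [mem_returnWords] at hw
  exact mem_langWords.2 ⟨hw.1, InLang.of_append_left (x := [true]) hw.2.1⟩

theorem sum_returnWords_pow_le (hc0 : 0 < c0) (hc1 : 0 < c1) (t : ℝ) (n k : ℕ) :
    (∑ ω ∈ returnWords S n, wt c0 c1 ω ^ t) ^ (k + 1) ≤
      ∑ ω ∈ returnWords S (n * (k + 1)), wt c0 c1 ω ^ t := by
  induction k with
  | zero => simp
  | succ k ih =>
    have h0 : 0 ≤ ∑ ω ∈ returnWords S n, wt c0 c1 ω ^ t :=
      Finset.sum_nonneg fun w _ => Real.rpow_nonneg (wt_pos hc0 hc1 w).le t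
    rw [pow_succ, mul_add_one]
    exact (mul_le_mul_of_nonneg_right ih h0).trans (sum_returnWords_mul_le hc0 hc1 t _ _)

theorem sum_returnWords_le_exp (hc0 : 0 < c0) (hc1 : 0 < c1) {t p : ℝ}
    (hp : Tendsto (fun n : ℕ => (1 / (n : ℝ)) * Real.log (∑ ω ∈ langWords S n, wt c0 c1 ω ^ t))
      atTop (nhds p)) {n : ℕ} (hn : 0 < n) :
    ∑ ω ∈ returnWords S n, wt c0 c1 ω ^ t ≤ Real.exp p ^ n := by
  set g := ∑ ω ∈ returnWords S n, wt c0 c1 ω ^ t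
  rcases le_or_gt g 0 with h0 | h0
  · exact h0.trans (by positivity)
  have hn' : (0 : ℝ) < n := by exact_mod_cast hn
  have hlim : Tendsto (fun k : ℕ => n * (k + 1)) atTop atTop :=
    (tendsto_add_atTop_nat 1).const_mul_atTop' hn
  have key : Real.log g / n ≤ p := by
    refine ge_of_tendsto' (hp.comp hlim) fun k => ?_
    have h := Real.log_le_log (by positivity) ((sum_returnWords_pow_le hc0 hc1 t n k).trans
      (sum_returnWords_le_sum_langWords hc0 hc1 t _))
    rw [Real.log_pow] at h
    simp only [Function.comp_apply]
    rw [one_div, ← div_eq_inv_mul, div_le_div_iff₀ hn' (by positivity)]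
    push_cast at h ⊢
    nlinarith
  rw [← Real.exp_nat_mul, ← Real.log_le_iff_le_exp h0]
  rwa [div_le_iff₀' hn'] at key

end Sums

/-- A sequence with `x (n + 1) ≤ a * x n + D * r ^ n`, where `a < r`, is `O(r ^ n)`. -/
theorem le_mul_pow_of_succ_le {x : ℕ → ℝ} {a r C D : ℝ} (ha : 0 ≤ a) (har : a < r)
    (h0 : x 0 ≤ C) (hD : 0 ≤ D) (hx : ∀ n, x (n + 1) ≤ a * x n + D * r ^ n) (hC : 0 ≤ C)
    (n : ℕ) : x n ≤ (C + D / (r - a)) * r ^ n := by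
  have hr : 0 < r - a := sub_pos.2 har
  have hr' : 0 < r := ha.trans_lt har
  induction n with
  | zero =>
    have : 0 ≤ D / (r - a) := by positivity
    simpa using h0.trans (by linarith)
  | succ n ih =>
    have hK : a * (C + D / (r - a)) + D ≤ (C + D / (r - a)) * r := by
      have : D / (r - a) * (r - a) = D := div_mul_cancel₀ _ hr.ne'
      nlinarith
    calc x (n + 1) ≤ a * x n + D * r ^ n := hx n
      _ ≤ a * ((C + D / (r - a)) * r ^ n) + D * r ^ n := by gcongr
      _ = (a * (C + D / (r - a)) + D) * r ^ n := by ring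
      _ ≤ (C + D / (r - a)) * r * r ^ n := by gcongr
      _ = (C + D / (r - a)) * r ^ (n + 1) := by ring

theorem sum_wt_rpow_le_one_of_length_zero (c0 c1 t : ℝ) {A : Finset (List Bool)}
    (hA : ∀ w ∈ A, w.length = 0) : ∑ ω ∈ A, wt c0 c1 ω ^ t ≤ 1 := by
  have hsub : A ⊆ {[]} := fun w hw => by simpa using hA w hw
  rcases Finset.subset_singleton_iff.1 hsub with rfl | rfl <;> simp [wt]

/-- If c₀^t < e^{P(t)} and c₁^t < e^{P(t)}, then there is K₁ > 0 with
∑_{ω ∈ L_n} c_ω^t ≤ K₁·e^{n·P(t)} for every n ≥ 1. -/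
theorem stmt2
    (S : Set ℕ) (hS : S.Infinite)
    (c0 c1 cb0 cb1 : ℝ)
    (hc0 : 0 < c0) (hc0b : c0 ≤ cb0) (hcb0 : cb0 < 1)
    (hc1 : 0 < c1) (hc1b : c1 ≤ cb1) (hcb1 : cb1 < 1)
    (P Pb : ℝ → ℝ)
    (hP : ∀ t : ℝ, Filter.Tendsto
      (fun n : ℕ => (1 / (n : ℝ)) * Real.log (∑ ω ∈ langWords S n, wt c0 c1 ω ^ t))
      Filter.atTop (nhds (P t)))
    (hPb : ∀ t : ℝ, Filter.Tendsto
      (fun n : ℕ => (1 / (n : ℝ)) * Real.log (∑ ω ∈ langWords S n, wt cb0 cb1 ω ^ t))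
      Filter.atTop (nhds (Pb t)))
    (t : ℝ) (ht0 : c0 ^ t < Real.exp (P t)) (ht1 : c1 ^ t < Real.exp (P t)) :
    ∃ K₁ : ℝ, 0 < K₁ ∧ ∀ n : ℕ, 1 ≤ n →
      ∑ ω ∈ langWords S n, wt c0 c1 ω ^ t ≤ K₁ * Real.exp (n * P t) := by
  set r := Real.exp (P t)
  have ha : 0 ≤ c0 ^ t := Real.rpow_nonneg hc0.le t
  have hb : 0 ≤ c1 ^ t := Real.rpow_nonneg hc1.le t
  have hr0 : 0 < r := Real.exp_pos _
  have hra : 0 < r - c0 ^ t := sub_pos.2 ht0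
  have hfollow := le_mul_pow_of_succ_le (x := fun n => ∑ ω ∈ followWords S n, wt c0 c1 ω ^ t)
    ha ht0 (sum_wt_rpow_le_one_of_length_zero c0 c1 t fun w hw => (mem_followWords.1 hw).1)
    hr0.le (fun n => (sum_followWords_succ_le hc0 hc1 t n).trans (by
      rw [← pow_succ']
      gcongr
      exact sum_returnWords_le_exp hc0 hc1 (hP t) n.succ_pos)) zero_le_one
  have hlang := le_mul_pow_of_succ_le (x := fun n => ∑ ω ∈ langWords S n, wt c0 c1 ω ^ t)
    (D := c1 ^ t * (1 + r / (r - c0 ^ t)))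
    ha ht0 (sum_wt_rpow_le_one_of_length_zero c0 c1 t fun w hw => (mem_langWords.1 hw).1)
    (by positivity) (fun n => (sum_langWords_succ_le hc0 hc1 t n).trans (by
      rw [mul_assoc (c1 ^ t)]
      gcongr
      exact hfollow n)) zero_le_one
  refine ⟨1 + c1 ^ t * (1 + r / (r - c0 ^ t)) / (r - c0 ^ t), by positivity, fun n _ => ?_⟩
  rw [Real.exp_nat_mul]
  exact hlang n
end

section
/- Let H > 0 be a real number. Then Q̄(H) = 0 if and only if ∑_{s ∈ S} c̄₀^{s·H}·c̄₁^H = 1, where the sum over s ∈ S is taken in [0,∞]. -/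
open Filter

/-- Extended-real logarithm with `log 0 = -∞`. -/
noncomputable def elog (x : ℝ) : EReal := if x = 0 then ⊥ else ((Real.log x : ℝ) : EReal)

/-- `Q(t) = limsup_{n → ∞} (1/n) log (∑_{ω ∈ G_n} c_ω^t)`, taken in the extended reals. -/
noncomputable def Qfun (S : Set ℕ) (c0 c1 : ℝ) (t : ℝ) : EReal :=
  limsup (fun n : ℕ =>
    ((1 / (n : ℝ) : ℝ) : EReal) * elog (∑ ω ∈ coreWords S n, wt c0 c1 ω ^ t)) atTop

section Renewal

variable {f u : ℕ → ℝ}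

/-- A renewal sequence whose gap weights have total mass at most one is bounded by one. -/
theorem renewal_le_one (hf : ∀ k, 0 ≤ f k) (hu0 : u 0 = 1)
    (hu : ∀ n, u (n + 1) = ∑ k ∈ Finset.range (n + 1), f k * u (n - k))
    (hs : Summable f) (h1 : ∑' k, f k ≤ 1) (n : ℕ) : u n ≤ 1 := by
  induction n using Nat.strong_induction_on with
  | _ n ih =>
    cases n with
    | zero => exact hu0.le
    | succ n =>
      rw [hu]
      calc ∑ k ∈ Finset.range (n + 1), f k * u (n - k)
          ≤ ∑ k ∈ Finset.range (n + 1), f k :=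
            Finset.sum_le_sum fun k _ => mul_le_of_le_one_right (hf k) (ih _ (by omega))
        _ ≤ ∑' k, f k := hs.sum_le_tsum _ fun k _ => hf k
        _ ≤ 1 := h1

/-- A renewal sequence whose gap weights have total mass at least one is not summable. -/
theorem renewal_not_summable (hu0 : u 0 = 1) (hun : ∀ n, 0 ≤ u n)
    (hu : ∀ n, u (n + 1) = ∑ k ∈ Finset.range (n + 1), f k * u (n - k))
    (hs : Summable f) (h1 : 1 ≤ ∑' k, f k) : ¬ Summable u := by
  intro hsu
  have hprod : (∑' k, f k) * ∑' n, u n = ∑' n, u (n + 1) := by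
    rw [tsum_mul_tsum_eq_tsum_sum_range_of_summable_norm hs.norm hsu.norm]
    exact tsum_congr fun n => (hu n).symm
  have hsplit := hsu.tsum_eq_zero_add
  have hnonneg : 0 ≤ ∑' n, u n := tsum_nonneg hun
  rw [hu0, ← hprod] at hsplit
  nlinarith

/-- Rescaling a renewal equation by powers of `r`. -/
theorem renewal_rescale (hu : ∀ n, u (n + 1) = ∑ k ∈ Finset.range (n + 1), f k * u (n - k))
    (r : ℝ) (n : ℕ) :
    u (n + 1) * r ^ (n + 1) =
      ∑ k ∈ Finset.range (n + 1), f k * r ^ (k + 1) * (u (n - k) * r ^ (n - k)) := by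
  rw [hu, Finset.sum_mul]
  refine Finset.sum_congr rfl fun k hk => ?_
  have : n + 1 = (k + 1) + (n - k) := by
    have := Finset.mem_range.1 hk
    omega
  rw [this, pow_add]
  ring

end Renewal

theorem one_div_mul_elog_le {x r : ℝ} {n : ℕ} (hn : 0 < n) (hr : 0 < r) (hx : 0 ≤ x)
    (h : x * r ^ n ≤ 1) :
    ((1 / (n : ℝ) : ℝ) : EReal) * elog x ≤ ((-Real.log r : ℝ) : EReal) := by
  have hn' : (0 : ℝ) < n := by exact_mod_cast hn
  rcases hx.eq_or_lt with rfl | hx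
  · rw [elog, if_pos rfl, EReal.coe_mul_bot_of_pos (by positivity)]
    exact bot_le
  · rw [elog, if_neg hx.ne', ← EReal.coe_mul, EReal.coe_le_coe_iff, one_div,
      inv_mul_le_iff₀ hn']
    have := Real.log_nonpos (by positivity) h
    rw [Real.log_mul hx.ne' (by positivity), Real.log_pow] at this
    linarith

theorem le_exp_of_one_div_mul_elog_lt {x c : ℝ} {n : ℕ} (hn : 0 < n) (hx : 0 ≤ x)
    (h : ((1 / (n : ℝ) : ℝ) : EReal) * elog x < (c : EReal)) : x ≤ Real.exp c ^ n := by
  have hn' : (0 : ℝ) < n := by exact_mod_cast hn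
  rcases hx.eq_or_lt with rfl | hx
  · positivity
  · rw [elog, if_neg hx.ne', ← EReal.coe_mul, EReal.coe_lt_coe_iff, one_div,
      inv_mul_lt_iff₀ hn'] at h
    rw [← Real.exp_nat_mul, ← Real.log_le_iff_le_exp hx]
    exact h.le

theorem limsup_elog_le {u : ℕ → ℝ} {r : ℝ} (hr : 0 < r) (hun : ∀ n, 0 ≤ u n)
    (h : ∀ n, u n * r ^ n ≤ 1) :
    limsup (fun n : ℕ => ((1 / (n : ℝ) : ℝ) : EReal) * elog (u n)) atTop ≤
      ((-Real.log r : ℝ) : EReal) := by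
  refine limsup_le_of_le (by isBoundedDefault) ?_
  filter_upwards [eventually_gt_atTop 0] with n hn
  exact one_div_mul_elog_le hn hr (hun n) (h n)

theorem le_limsup_elog {u : ℕ → ℝ} {r : ℝ} (hr : 0 < r) (hun : ∀ n, 0 ≤ u n)
    (h : ¬ Summable fun n => u n * r ^ n) :
    ((-Real.log r : ℝ) : EReal) ≤
      limsup (fun n : ℕ => ((1 / (n : ℝ) : ℝ) : EReal) * elog (u n)) atTop := by
  by_contra! hlt
  obtain ⟨c, hc, hcr⟩ := EReal.lt_iff_exists_real_btwn.1 hlt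
  rw [EReal.coe_lt_coe_iff] at hcr
  have hgeom : Real.exp c * r < 1 := by
    rw [← Real.exp_log hr, ← Real.exp_add, Real.exp_lt_one_iff]
    linarith
  refine h (Summable.of_norm_bounded_eventually_nat
    (summable_geometric_of_lt_one (by positivity) hgeom) ?_)
  filter_upwards [eventually_lt_of_limsup_lt hc, eventually_gt_atTop 0] with n hn hn0
  rw [Real.norm_of_nonneg (mul_nonneg (hun n) (by positivity)), mul_pow]
  gcongr
  exact le_exp_of_one_div_mul_elog_lt hn0 (hun n) hn

theorem wt_block (c0 c1 : ℝ) (s : ℕ) (w : List Bool) :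
    wt c0 c1 (List.replicate s false ++ true :: w) = c0 ^ s * (c1 * wt c0 c1 w) := by
  simp [wt]

theorem wt_nonneg {c0 c1 : ℝ} (h0 : 0 ≤ c0) (h1 : 0 ≤ c1) (w : List Bool) :
    0 ≤ wt c0 c1 w := by
  refine List.prod_nonneg fun x hx => ?_
  obtain ⟨b, -, rfl⟩ := List.mem_map.1 hx
  cases b <;> simpa

theorem block_injective {s t : ℕ} {v w : List Bool}
    (h : List.replicate s false ++ true :: v = List.replicate t false ++ true :: w) :
    s = t ∧ v = w := by
  induction s generalizing t with
  | zero => cases t <;> simp_all [List.replicate_succ]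
  | succ s ih =>
    cases t with
    | zero => simp [List.replicate_succ] at h
    | succ t =>
      simp only [List.replicate_succ, List.cons_append, List.cons.injEq, true_and] at h
      simpa using ih h

/-- Core words of length `n`, together with the empty word when `n = 0`. -/
noncomputable def coreWordsOrNil (S : Set ℕ) (n : ℕ) : Finset (List Bool) :=
  if n = 0 then {[]} else coreWords S n

theorem mem_coreWordsOrNil {S : Set ℕ} {n : ℕ} {w : List Bool} :
    w ∈ coreWordsOrNil S n ↔ w.length = n ∧ ∃ bs : List ℕ, (∀ s ∈ bs, s ∈ S) ∧
      w = (bs.map fun s => List.replicate s false ++ [true]).flatten := by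
  rw [coreWordsOrNil]
  split_ifs with hn
  · subst hn
    simp only [Finset.mem_singleton, List.length_eq_zero_iff]
    exact ⟨fun h => ⟨h, [], by simp, by simpa using h⟩, fun h => h.1⟩
  · rw [mem_coreWords]
    refine and_congr_right fun hw => ⟨fun ⟨bs, _, h⟩ => ⟨bs, h⟩, fun ⟨bs, h⟩ => ⟨bs, ?_, h⟩⟩
    rintro rfl
    simp [h.2] at hw
    omega

open Classical in
/-- Decomposition of nonempty core words according to the first block. -/
theorem coreWordsOrNil_succ (S : Set ℕ) (n : ℕ) :
    coreWordsOrNil S (n + 1) = ((Finset.range (n + 1)).filter (· ∈ S)).biUnion fun s =>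
      (coreWordsOrNil S (n - s)).image fun w => List.replicate s false ++ true :: w := by
  ext w
  simp only [Finset.mem_biUnion, Finset.mem_image, Finset.mem_filter, Finset.mem_range,
    mem_coreWordsOrNil]
  constructor
  · rintro ⟨hl, bs, hbs, rfl⟩
    cases bs with
    | nil => simp at hl
    | cons s bs =>
      simp only [List.mem_cons, forall_eq_or_imp] at hbs
      rw [List.map_cons, List.flatten_cons, List.length_append, List.length_append,
        List.length_replicate, List.length_singleton] at hl
      exact ⟨s, ⟨by omega, hbs.1⟩, _, ⟨by omega, bs, hbs.2, rfl⟩, by simp⟩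
  · rintro ⟨s, ⟨hs, hsS⟩, v, ⟨hl, bs, hbs, rfl⟩, rfl⟩
    refine ⟨?_, s :: bs, by simpa using ⟨hsS, hbs⟩, by simp⟩
    rw [List.length_append, List.length_cons, hl, List.length_replicate]
    omega

/-- The weight sums over core words satisfy the renewal equation. -/
theorem sum_coreWordsOrNil_succ (S : Set ℕ) {c0 c1 : ℝ} (h0 : 0 ≤ c0) (h1 : 0 ≤ c1)
    (H : ℝ) (n : ℕ) :
    ∑ w ∈ coreWordsOrNil S (n + 1), wt c0 c1 w ^ H =
      ∑ k ∈ Finset.range (n + 1), S.indicator (fun s => (c0 ^ H) ^ s * c1 ^ H) k *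
        ∑ w ∈ coreWordsOrNil S (n - k), wt c0 c1 w ^ H := by
  classical
  rw [coreWordsOrNil_succ, Finset.sum_biUnion, Finset.sum_filter]
  · refine Finset.sum_congr rfl fun s _ => ?_
    by_cases hs : s ∈ S
    · rw [if_pos hs, Set.indicator_of_mem hs,
        Finset.sum_image fun v _ w _ h => (block_injective h).2, Finset.mul_sum]
      refine Finset.sum_congr rfl fun w _ => ?_
      have hw := wt_nonneg h0 h1 w
      rw [wt_block, Real.mul_rpow (by positivity) (by positivity), Real.mul_rpow h1 hw,
        Real.rpow_pow_comm h0, mul_assoc]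
    · rw [if_neg hs, Set.indicator_of_notMem hs, zero_mul]
  · intro s _ t _ hst
    rw [Function.onFun, Finset.disjoint_left]
    intro w hw hw'
    obtain ⟨v, -, rfl⟩ := Finset.mem_image.1 hw
    obtain ⟨v', -, h⟩ := Finset.mem_image.1 hw'
    exact hst (block_injective h).1.symm

theorem Qfun_eq_limsup_coreWordsOrNil (S : Set ℕ) (c0 c1 H : ℝ) :
    Qfun S c0 c1 H = limsup (fun n : ℕ => ((1 / (n : ℝ) : ℝ) : EReal) *
      elog (∑ w ∈ coreWordsOrNil S n, wt c0 c1 w ^ H)) atTop := by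
  refine limsup_congr ?_
  filter_upwards [eventually_gt_atTop 0] with n hn
  rw [coreWordsOrNil, if_neg hn.ne']

section GapSeries

variable {f : ℕ → ℝ} {a b : ℝ}

theorem summable_gap_mul_pow (hf : ∀ k, 0 ≤ f k) (hfa : ∀ k, f k ≤ a ^ k * b)
    (ha : 0 ≤ a) {r : ℝ} (hr : 0 ≤ r) (har : a * r < 1) :
    Summable fun k => f k * r ^ (k + 1) := by
  refine Summable.of_nonneg_of_le (fun k => mul_nonneg (hf k) (by positivity)) (fun k => ?_)
    ((summable_geometric_of_lt_one (mul_nonneg ha hr) har).mul_right (b * r))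
  calc f k * r ^ (k + 1) ≤ a ^ k * b * r ^ (k + 1) := by gcongr; exact hfa k
    _ = (a * r) ^ k * (b * r) := by ring

theorem continuousAt_tsum_gap_mul_pow (hf : ∀ k, 0 ≤ f k) (hfa : ∀ k, f k ≤ a ^ k * b)
    (ha : 0 < a) (ha1 : a < 1) :
    ContinuousAt (fun r : ℝ => ∑' k, f k * r ^ (k + 1)) 1 := by
  obtain ⟨R, hR1, hR⟩ := exists_between ((one_lt_inv₀ ha).2 ha1)
  have haR : a * R < 1 := by
    simpa [ha.ne'] using mul_lt_mul_of_pos_left hR ha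
  have hcont : ContinuousOn (fun r : ℝ => ∑' k, f k * r ^ (k + 1)) (Set.Icc 0 R) := by
    refine continuousOn_tsum (fun k => by fun_prop)
      (summable_gap_mul_pow hf hfa ha.le (by linarith) haR) fun k r hr => ?_
    have hfk := hf k
    have hr0 := hr.1
    rw [Real.norm_of_nonneg (by positivity)]
    gcongr
    exact hr.2
  exact hcont.continuousAt (Icc_mem_nhds one_pos hR1)

end GapSeries

/-- For H > 0, Q̄(H) = 0 iff ∑_{s ∈ S} c̄₀^{s·H}·c̄₁^H = 1 (sum in [0,∞]). -/
theorem stmt9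
    (S : Set ℕ) (hS : S.Infinite)
    (c0 c1 cb0 cb1 : ℝ)
    (hc0 : 0 < c0) (hc0b : c0 ≤ cb0) (hcb0 : cb0 < 1)
    (hc1 : 0 < c1) (hc1b : c1 ≤ cb1) (hcb1 : cb1 < 1)
    (H : ℝ) (hH : 0 < H) :
    Qfun S cb0 cb1 H = 0 ↔
      ∑' s : S, ENNReal.ofReal (cb0 ^ (((s : ℕ) : ℝ) * H) * cb1 ^ H) = 1 := by
  set a := cb0 ^ H with ha_def
  set b := cb1 ^ H with hb_def
  have hcb0' : 0 < cb0 := hc0.trans_le hc0b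
  have hcb1' : 0 < cb1 := hc1.trans_le hc1b
  have ha : 0 < a := Real.rpow_pos_of_pos hcb0' H
  have hb : 0 < b := Real.rpow_pos_of_pos hcb1' H
  have ha1 : a < 1 := Real.rpow_lt_one hcb0'.le hcb0 hH
  set f : ℕ → ℝ := S.indicator fun s => a ^ s * b with hf_def
  have hf : ∀ k, 0 ≤ f k := fun k => Set.indicator_nonneg (fun s _ => by positivity) k
  have hfa : ∀ k, f k ≤ a ^ k * b := fun k =>
    Set.indicator_le_self' (fun s _ => by positivity) k
  have hsum : ∀ {r : ℝ}, 0 ≤ r → a * r < 1 → Summable fun k => f k * r ^ (k + 1) :=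
    fun hr har => summable_gap_mul_pow hf hfa ha.le hr har
  have hf_summable : Summable f := by simpa using hsum zero_le_one (by simpa using ha1)
  have hrhs : ∑' s : S, ENNReal.ofReal (cb0 ^ (((s : ℕ) : ℝ) * H) * b) =
      ENNReal.ofReal (∑' k, f k) := by
    rw [ENNReal.ofReal_tsum_of_nonneg hf hf_summable,
      tsum_subtype S fun s : ℕ => ENNReal.ofReal (cb0 ^ ((s : ℝ) * H) * b)]
    refine tsum_congr fun s => ?_
    by_cases hs : s ∈ S
    · rw [hf_def, Set.indicator_of_mem hs, Set.indicator_of_mem hs, mul_comm (s : ℝ) H,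
        Real.rpow_mul_natCast hcb0'.le]
    · rw [hf_def, Set.indicator_of_notMem hs, Set.indicator_of_notMem hs, ENNReal.ofReal_zero]
  rw [hrhs, ENNReal.ofReal_eq_one, Qfun_eq_limsup_coreWordsOrNil]
  set u : ℕ → ℝ := fun n => ∑ w ∈ coreWordsOrNil S n, wt cb0 cb1 w ^ H with hu_def
  have hun : ∀ n, 0 ≤ u n := fun n =>
    Finset.sum_nonneg fun w _ => Real.rpow_nonneg (wt_nonneg hcb0'.le hcb1'.le w) H
  have hu0 : u 0 = 1 := by simp [hu_def, coreWordsOrNil, wt]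
  have hu : ∀ n, u (n + 1) = ∑ k ∈ Finset.range (n + 1), f k * u (n - k) :=
    sum_coreWordsOrNil_succ S hcb0'.le hcb1'.le H
  have hupper : ∀ r : ℝ, 0 < r → a * r < 1 → ∑' k, f k * r ^ (k + 1) ≤ 1 →
      limsup (fun n : ℕ => ((1 / (n : ℝ) : ℝ) : EReal) * elog (u n)) atTop ≤
        ((-Real.log r : ℝ) : EReal) := fun r hr har h =>
    limsup_elog_le hr hun <| renewal_le_one (u := fun n => u n * r ^ n)
      (fun k => mul_nonneg (hf k) (by positivity)) (by simp [hu0]) (renewal_rescale hu r)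
      (hsum hr.le har) h
  have hlower : ∀ r : ℝ, 0 < r → a * r < 1 → 1 ≤ ∑' k, f k * r ^ (k + 1) →
      ((-Real.log r : ℝ) : EReal) ≤
        limsup (fun n : ℕ => ((1 / (n : ℝ) : ℝ) : EReal) * elog (u n)) atTop :=
    fun r hr har h =>
    le_limsup_elog hr hun <| renewal_not_summable (by simp [hu0])
      (fun n => mul_nonneg (hun n) (by positivity)) (renewal_rescale hu r)
      (hsum hr.le har) h
  have hcont := continuousAt_tsum_gap_mul_pow hf hfa ha ha1
  constructor
  · intro hQ
    change limsup (fun n : ℕ => ((1 / (n : ℝ) : ℝ) : EReal) * elog (u n)) atTop = 0 at hQ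
    rcases lt_trichotomy (∑' k, f k) 1 with hlt | heq | hgt
    · exfalso
      have hev : ∀ᶠ r : ℝ in nhds 1, ∑' k, f k * r ^ (k + 1) < 1 :=
        hcont.eventually_lt_const (by simpa using hlt)
      have hev' : ∀ᶠ r : ℝ in nhds 1, a * r < 1 :=
        (by fun_prop : ContinuousAt (fun r : ℝ => a * r) 1).eventually_lt_const
          (by simpa using ha1)
      obtain ⟨r, ⟨hr, har⟩, hr1 : 1 < r⟩ := (((hev.and hev').filter_mono
        nhdsWithin_le_nhds).and (self_mem_nhdsWithin (s := Set.Ioi (1 : ℝ)))).exists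
      have h := hupper r (by linarith) har hr.le
      rw [hQ, ← EReal.coe_zero, EReal.coe_le_coe_iff] at h
      have := Real.log_pos hr1
      linarith
    · exact heq
    · exfalso
      have hev : ∀ᶠ r : ℝ in nhds 1, 1 < ∑' k, f k * r ^ (k + 1) :=
        hcont.eventually_const_lt (by simpa using hgt)
      obtain ⟨r, ⟨hr, hr0⟩, hr1 : r < 1⟩ := (((hev.and (lt_mem_nhds one_pos)).filter_mono
        nhdsWithin_le_nhds).and (self_mem_nhdsWithin (s := Set.Iio (1 : ℝ)))).exists
      have h := hlower r hr0 (by nlinarith) hr.le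
      rw [hQ, ← EReal.coe_zero, EReal.coe_le_coe_iff] at h
      have := Real.log_neg hr0 hr1
      linarith
  · intro h1
    refine le_antisymm ?_ ?_
    · simpa using hupper 1 one_pos (by simpa using ha1) (by simpa using h1.le)
    · simpa using hlower 1 one_pos (by simpa using ha1) (by simpa using h1.ge)
end
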